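/- Let j and k be natural numbers with j ≥ 2 and k ≥ 1, and let B and R be matrices in SO(3) such that tr(B) > 1 + 2·cos(π/j). Set C = B⁻¹·R⁻¹·B·R, and assume C ≠ 1 and tr(C) = 1 + 2·cos(2π/k). Then k > j. -/

import Mathlib

open Matrix

/-- Twice the axial vector of the antisymmetric part of a `3 × 3` matrix. -/
def axialVec (B : Matrix (Fin 3) (Fin 3) ℝ) : Fin 3 → ℝ :=
  ![B 2 1 - B 1 2, B 0 2 - B 2 0, B 1 0 - B 0 1]

/-- The symmetric part of a rotation of trace `t` is determined by `t` and the axial vector. -/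
lemma axialVec_mul_axialVec {B : Matrix (Fin 3) (Fin 3) ℝ} (hB : Bᵀ * B = 1)
    (hdet : B.det = 1) (i j : Fin 3) :
    axialVec B i * axialVec B j =
      (B.trace + 1) * (B i j + B j i) -
        (B.trace ^ 2 - 1) * (1 : Matrix (Fin 3) (Fin 3) ℝ) i j := by
  have hB' : B * Bᵀ = 1 := mul_eq_one_comm.mp hB
  have hadj : adjugate B = Bᵀ := by
    have h : Bᵀ * (B * adjugate B) = Bᵀ := by rw [mul_adjugate, hdet, one_smul, mul_one]
    rwa [← mul_assoc, hB, one_mul] at h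
  have hcol := fun i j => congrFun (congrFun hB i) j
  have hrow := fun i j => congrFun (congrFun hB' i) j
  have hcof := fun i j => congrFun (congrFun hadj i) j
  simp only [adjugate_fin_three, Fin.forall_fin_succ, mul_apply, Fin.sum_univ_three,
    transpose_apply, one_apply] at hcol hrow hcof
  simp at hcol hrow hcof
  fin_cases i <;> fin_cases j <;> simp [axialVec, trace_fin_three] <;> grind

/-- The rotation angle of `Aᵀ * D` is at most twice that of `A`, if `A` and `D` are rotations
with the same angle, at most a right angle. -/
lemma sq_sub_two_mul_trace_le_trace_transpose_mul {A D : Matrix (Fin 3) (Fin 3) ℝ}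
    (hA : Aᵀ * A = 1) (hAdet : A.det = 1) (hD : Dᵀ * D = 1) (hDdet : D.det = 1)
    (htr : D.trace = A.trace) (ht : 1 ≤ A.trace) :
    A.trace ^ 2 - 2 * A.trace ≤ (Aᵀ * D).trace := by
  have ha := axialVec_mul_axialVec hA hAdet
  have hd := axialVec_mul_axialVec hD hDdet
  rw [htr] at hd
  have hAtr := trace_fin_three A
  have hDtr := htr.symm.trans (trace_fin_three D)
  set t := A.trace
  set p := ∑ i, axialVec A i * axialVec D i with hp
  have hqa : ∑ i, axialVec A i * axialVec A i = (t + 1) * (3 - t) := by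
    simp only [ha, Fin.sum_univ_three, one_apply_eq]
    linear_combination -2 * (t + 1) * hAtr
  have hqd : ∑ i, axialVec D i * axialVec D i = (t + 1) * (3 - t) := by
    simp only [hd, Fin.sum_univ_three, one_apply_eq]
    linear_combination -2 * (t + 1) * hDtr
  have hadd : 0 ≤ p + (t + 1) * (3 - t) := by
    have h : 0 ≤ ∑ i, (axialVec A i + axialVec D i) ^ 2 :=
      Finset.sum_nonneg fun i _ => sq_nonneg _
    simp only [hp, Fin.sum_univ_three] at h hqa hqd ⊢
    linarith
  have key : 4 * (t + 1) ^ 2 * (Aᵀ * D).trace =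
      3 * (t ^ 2 - 1) ^ 2 + 2 * (t ^ 2 - 1) * ((t + 1) * (3 - t)) + p ^ 2
        + 2 * (t + 1) ^ 2 * p := by
    have hsym : ∑ i, ∑ j, ((t + 1) * (A i j + A j i)) * ((t + 1) * (D i j + D j i)) =
        3 * (t ^ 2 - 1) ^ 2 + 2 * (t ^ 2 - 1) * ((t + 1) * (3 - t)) + p ^ 2 := by
      have ha' : ∀ i j, (t + 1) * (A i j + A j i) = axialVec A i * axialVec A j +
          (t ^ 2 - 1) * (1 : Matrix (Fin 3) (Fin 3) ℝ) i j := fun i j => by rw [ha]; ring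
      have hd' : ∀ i j, (t + 1) * (D i j + D j i) = axialVec D i * axialVec D j +
          (t ^ 2 - 1) * (1 : Matrix (Fin 3) (Fin 3) ℝ) i j := fun i j => by rw [hd]; ring
      simp only [ha', hd', hp, Fin.sum_univ_three, one_apply] at hqa hqd ⊢
      simp
      linear_combination (t ^ 2 - 1) * hqa + (t ^ 2 - 1) * hqd
    have hexp : 4 * (t + 1) ^ 2 * (Aᵀ * D).trace =
        ∑ i, ∑ j, ((t + 1) * (A i j + A j i)) * ((t + 1) * (D i j + D j i))
          + 2 * (t + 1) ^ 2 * p := by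
      simp only [hp, trace_fin_three, mul_apply, transpose_apply, Fin.sum_univ_three, axialVec]
      simp
      ring
    rw [hexp, hsym]
  have hprod : 0 ≤ (p + (t + 1) * (3 - t)) *
      ((p + (t + 1) * (3 - t)) + 4 * (t + 1) * (t - 1)) :=
    mul_nonneg hadd (add_nonneg hadd (by nlinarith))
  refine le_of_mul_le_mul_left ?_ (show 0 < 4 * (t + 1) ^ 2 by positivity)
  rw [key]
  linarith

/-- The identity is the only orthogonal matrix of trace `3` in dimension `3`. -/
lemma eq_one_of_transpose_mul_self_of_trace {C : Matrix (Fin 3) (Fin 3) ℝ}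
    (hC : Cᵀ * C = 1) (htr : C.trace = 3) : C = 1 := by
  have h : ((C - 1)ᵀ * (C - 1)).trace = 0 := by
    simp [sub_mul, mul_sub, hC, htr]
  rw [← conjTranspose_eq_transpose_of_trivial, trace_conjTranspose_mul_self_eq_zero_iff] at h
  exact sub_eq_zero.mp h

/-- If `B, R ∈ SO(3)`, `tr B > 1 + 2 cos (π/j)` with `j ≥ 2`, and the commutator
`C = B⁻¹ R⁻¹ B R` is a nontrivial rotation with `tr C = 1 + 2 cos (2π/k)` for `k ≥ 1`,
then `k > j`. -/
theorem commutator_order_gt_SO3 (j k : ℕ) (hj : 2 ≤ j) (hk : 1 ≤ k)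
    (B R : Matrix (Fin 3) (Fin 3) ℝ)
    (hB : Bᵀ * B = 1) (hBdet : B.det = 1)
    (hR : Rᵀ * R = 1) (hRdet : R.det = 1)
    (htrB : B.trace > 1 + 2 * Real.cos (Real.pi / j))
    (C : Matrix (Fin 3) (Fin 3) ℝ) (hC : C = B⁻¹ * R⁻¹ * B * R)
    (hCne : C ≠ 1)
    (htrC : C.trace = 1 + 2 * Real.cos (2 * Real.pi / k)) :
    k > j := by
  have hB' : B * Bᵀ = 1 := mul_eq_one_comm.mp hB
  have hR' : R * Rᵀ = 1 := mul_eq_one_comm.mp hR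
  have hCD : C = Bᵀ * (Rᵀ * B * R) := by
    rw [hC, inv_eq_left_inv hB, inv_eq_left_inv hR]
    simp only [mul_assoc]
  have hD : (Rᵀ * B * R)ᵀ * (Rᵀ * B * R) = 1 := by
    calc (Rᵀ * B * R)ᵀ * (Rᵀ * B * R) = Rᵀ * (Bᵀ * (R * Rᵀ) * B) * R := by
          simp only [transpose_mul, transpose_transpose, mul_assoc]
      _ = 1 := by rw [hR', mul_one, hB, mul_one, hR]
  have hCorth : Cᵀ * C = 1 := by
    calc Cᵀ * C = (Rᵀ * B * R)ᵀ * (B * Bᵀ) * (Rᵀ * B * R) := by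
          rw [hCD, transpose_mul, transpose_transpose]
          simp only [mul_assoc]
      _ = 1 := by rw [hB', mul_one, hD]
  have hDdet : (Rᵀ * B * R).det = 1 := by simp [hBdet, hRdet]
  have hDtr : (Rᵀ * B * R).trace = B.trace := by
    rw [mul_assoc, trace_mul_comm, mul_assoc, hR', mul_one]
  have hj' : (2 : ℝ) ≤ j := by exact_mod_cast hj
  have hcos : 0 ≤ Real.cos (Real.pi / j) := by
    apply Real.cos_nonneg_of_neg_pi_div_two_le_of_le
    · have : 0 ≤ Real.pi / j := by positivity
      linarith [Real.pi_pos]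
    · gcongr
  have hle := sq_sub_two_mul_trace_le_trace_transpose_mul hB hBdet hD hDdet hDtr (by linarith)
  rw [← hCD, htrC] at hle
  have hlt : Real.cos (2 * Real.pi / j) < Real.cos (2 * Real.pi / k) := by
    rw [mul_div_assoc 2 Real.pi (j : ℝ), Real.cos_two_mul]
    nlinarith
  have hk2 : 2 ≤ k := by
    rcases hk.eq_or_lt with rfl | h
    · refine absurd (eq_one_of_transpose_mul_self_of_trace hCorth ?_) hCne
      rw [htrC, Nat.cast_one, div_one, Real.cos_two_pi]
      norm_num
    · exact h
  by_contra! hkj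
  have hk2' : (2 : ℝ) ≤ k := by exact_mod_cast hk2
  refine hlt.not_ge (Real.cos_le_cos_of_nonneg_of_le_pi (by positivity) ?_ ?_)
  · rw [div_le_iff₀ (by linarith)]
    nlinarith [Real.pi_pos]
  · gcongr
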